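/- arXiv:1301.5309 — 5 statements merged into one kernel-verified Lean document; each statement's English description precedes it below -/
import Mathlib

section
/- (Single masking identity, the key step in the entropy leakage lemmas.) Let X : Ω → ZMod 2 and Z : Ω → S be measurable random variables on a probability space, with S a finite type, and let G : Ω → Bool be Bernoulli(p)-distributed and independent of the pair ⟨X, Z⟩. Define the masked variable G·X : Ω → ZMod 2 by (G·X)(ω) = X(ω) if G(ω) = true and 0 otherwise. Then H(G·X | ⟨Z, G⟩) = p · H(X | Z). -/
open MeasureTheory ProbabilityTheory

/-- Shannon entropy (natural logarithm) of a finitely-valued random variable. -/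
noncomputable def entropy {Ω : Type*} [MeasurableSpace Ω] (μ : Measure Ω)
    {S : Type*} [Fintype S] (X : Ω → S) : ℝ :=
  ∑ s : S, Real.negMulLog (μ (X ⁻¹' {s})).toReal

/-- Conditional Shannon entropy `H(X | Y) = H(⟨X, Y⟩) - H(Y)` of finitely-valued
random variables (natural logarithm). -/
noncomputable def condEntropy {Ω : Type*} [MeasurableSpace Ω] (μ : Measure Ω)
    {S T : Type*} [Fintype S] [Fintype T] (X : Ω → S) (Y : Ω → T) : ℝ :=
  entropy μ (fun ω => (X ω, Y ω)) - entropy μ Y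

/-- Conditional mutual information `I(X : Y | Z)` of finitely-valued random variables. -/
noncomputable def condMutualInfo {Ω : Type*} [MeasurableSpace Ω] (μ : Measure Ω)
    {S T U : Type*} [Fintype S] [Fintype T] [Fintype U]
    (X : Ω → S) (Y : Ω → T) (Z : Ω → U) : ℝ :=
  condEntropy μ X Z + condEntropy μ Y Z - condEntropy μ (fun ω => (X ω, Y ω)) Z

/-- The masked variable `G·X`, equal to `X` where `G = true` and `0` where `G = false`. -/
def mask {Ω : Type*} (G : Ω → Bool) (X : Ω → ZMod 2) : Ω → ZMod 2 :=
  fun ω => if G ω then X ω else 0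

/-- Conditional entropy as a sum over the values of the conditioning variable. -/
lemma condEntropy_eq_sum {Ω : Type*} [MeasurableSpace Ω] (μ : Measure Ω)
    {S T : Type*} [Fintype S] [Fintype T] (X : Ω → S) (Y : Ω → T) :
    condEntropy μ X Y = ∑ t : T, (∑ s : S, Real.negMulLog (μ.real (X ⁻¹' {s} ∩ Y ⁻¹' {t})) -
      Real.negMulLog (μ.real (Y ⁻¹' {t}))) := by
  have hpre (s : S) (t : T) :
      (fun ω => (X ω, Y ω)) ⁻¹' {(s, t)} = X ⁻¹' {s} ∩ Y ⁻¹' {t} := by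
    ext ω
    simp
  simp only [condEntropy, entropy, Fintype.sum_prod_type_right, hpre, Finset.sum_sub_distrib,
    Measure.real]

/-- The fibres of a finitely-valued random variable partition the measure of any set. -/
lemma sum_measureReal_preimage_inter {Ω : Type*} [MeasurableSpace Ω] (μ : Measure Ω)
    [IsFiniteMeasure μ] {S : Type*} [Fintype S] [MeasurableSpace S]
    [MeasurableSingletonClass S] {X : Ω → S} (hX : Measurable X) (A : Set Ω) :
    ∑ s : S, μ.real (X ⁻¹' {s} ∩ A) = μ.real A := by
  have h := sum_measureReal_preimage_singleton (μ := μ.restrict A) (Finset.univ : Finset S)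
    (f := X) (fun s _ => hX (measurableSet_singleton s))
  simpa [measureReal_restrict_apply (hX (measurableSet_singleton _))] using h

/-- Scaling the weights `a s`, with total mass `b`, by `p` scales their unnormalized entropy
by `p`. -/
lemma sum_negMulLog_mul_sub {S : Type*} [Fintype S] (a : S → ℝ) (b p : ℝ)
    (hab : ∑ s, a s = b) :
    ∑ s, Real.negMulLog (p * a s) - Real.negMulLog (p * b) =
      p * (∑ s, Real.negMulLog (a s) - Real.negMulLog b) := by
  simp only [Real.negMulLog_mul, Finset.sum_add_distrib, ← Finset.sum_mul, ← Finset.mul_sum, hab]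
  ring

/-- **Single masking identity.** If `G` is Bernoulli(`p`) and independent of the pair
`⟨X, Z⟩`, then `H(G·X | ⟨Z, G⟩) = p · H(X | Z)`. -/
theorem stmt_2 {Ω : Type*} [MeasurableSpace Ω] (μ : Measure Ω) [IsProbabilityMeasure μ]
    {S : Type*} [Fintype S] [MeasurableSpace S] [MeasurableSingletonClass S]
    (X : Ω → ZMod 2) (Z : Ω → S) (G : Ω → Bool) (p : ℝ)
    (hX : Measurable X) (hZ : Measurable Z) (hG : Measurable G)
    (hp : p ∈ Set.Icc (0 : ℝ) 1)
    (hBer : μ (G ⁻¹' {true}) = ENNReal.ofReal p)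
    (hindep : IndepFun G (fun ω => (X ω, Z ω)) μ) :
    condEntropy μ (mask G X) (fun ω => (Z ω, G ω)) = p * condEntropy μ X Z := by
  have hGp : μ.real (G ⁻¹' {true}) = p := by
    rw [Measure.real, hBer, ENNReal.toReal_ofReal hp.1]
  have hmul {B : Set (ZMod 2 × S)} (hB : MeasurableSet B) :
      μ.real (G ⁻¹' {true} ∩ (fun ω => (X ω, Z ω)) ⁻¹' B) =
        p * μ.real ((fun ω => (X ω, Z ω)) ⁻¹' B) := by
    rw [← hGp]
    simp only [Measure.real, ← ENNReal.toReal_mul]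
    rw [hindep.measure_inter_preimage_eq_mul _ _ (measurableSet_singleton _) hB]
  have hZG (z : S) : μ.real ((fun ω => (Z ω, G ω)) ⁻¹' {(z, true)}) =
      p * μ.real (Z ⁻¹' {z}) := by
    have h := hmul (measurable_snd (measurableSet_singleton z))
    convert h using 2
    · ext ω
      simp [and_comm]
    · rfl
  have hXZG (x : ZMod 2) (z : S) :
      μ.real (mask G X ⁻¹' {x} ∩ (fun ω => (Z ω, G ω)) ⁻¹' {(z, true)}) =
        p * μ.real (X ⁻¹' {x} ∩ Z ⁻¹' {z}) := by
    have h := hmul ((measurableSet_singleton x).prod (measurableSet_singleton z))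
    convert h using 2
    · ext ω
      cases hω : G ω <;> simp [mask, hω]
    · rfl
  have hfalse (z : S) :
      ∑ x : ZMod 2, Real.negMulLog
          (μ.real (mask G X ⁻¹' {x} ∩ (fun ω => (Z ω, G ω)) ⁻¹' {(z, false)})) =
        Real.negMulLog (μ.real ((fun ω => (Z ω, G ω)) ⁻¹' {(z, false)})) := by
    rw [Finset.sum_eq_single_of_mem 0 (Finset.mem_univ _)]
    · congr 2
      ext ω
      cases hω : G ω <;> simp [mask, hω]
    · intro x _ hx
      have hempty :
          mask G X ⁻¹' {x} ∩ (fun ω => (Z ω, G ω)) ⁻¹' {(z, false)} = ∅ := by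
        ext ω
        cases hω : G ω <;> simp [mask, hω, hx.symm]
      simp [hempty]
  simp only [condEntropy_eq_sum, Fintype.sum_prod_type, Fintype.sum_bool, hfalse, sub_self,
    add_zero, hZG, hXZG, Finset.mul_sum]
  refine Finset.sum_congr rfl fun z _ => ?_
  rw [sum_negMulLog_mul_sub _ _ _ (sum_measureReal_preimage_inter μ hX _)]
end

section
/- (Double masking identity, the key step in the entropy leakage lemmas.) Let X : Ω → ZMod 2 and Z : Ω → S be measurable random variables on a probability space, with S a finite type, and let G₁, G₂ : Ω → Bool be independent Bernoulli(p)-distributed random variables with the pair (G₁, G₂) independent of the pair ⟨X, Z⟩. Then H(⟨G₁·X, G₂·X⟩ | ⟨Z, G₁, G₂⟩) = (1 − (1−p)²) · H(X | Z). -/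
open MeasureTheory ProbabilityTheory

/-- Entropy is invariant under injective maps of the values. -/
theorem entropy_comp_of_injective {Ω : Type*} [MeasurableSpace Ω] (μ : Measure Ω)
    {S T : Type*} [Fintype S] [Fintype T] (X : Ω → S) {f : S → T} (hf : f.Injective) :
    entropy μ (fun ω => f (X ω)) = entropy μ X := by
  refine (Fintype.sum_of_injective f hf _ _ (fun t ht => ?_) (fun s => ?_)).symm
  · have : (fun ω => f (X ω)) ⁻¹' {t} = ∅ :=
      Set.eq_empty_of_forall_notMem fun ω hω => ht ⟨X ω, hω⟩
    simp [this]
  · congr 3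
    ext ω
    simp [hf.eq_iff]

/-- The probabilities of the values of a finitely-valued random variable sum to one. -/
theorem sum_toReal_measure_preimage_singleton {Ω : Type*} [MeasurableSpace Ω] (μ : Measure Ω)
    [IsProbabilityMeasure μ] {S : Type*} [Fintype S] {X : Ω → S}
    (hX : ∀ s, MeasurableSet (X ⁻¹' {s})) :
    ∑ s : S, (μ (X ⁻¹' {s})).toReal = 1 := by
  rw [← ENNReal.toReal_sum fun s _ => measure_ne_top μ _,
    sum_measure_preimage_singleton _ fun s _ => hX s]
  simp

/-- Chain rule for `⟨F(G, W), G⟩` with `G` independent of `W`. -/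
theorem entropy_prodMk_of_indepFun {Ω : Type*} [MeasurableSpace Ω] (μ : Measure Ω)
    [IsProbabilityMeasure μ] {A B T : Type*} [Fintype A] [Fintype B] [Fintype T]
    [MeasurableSpace A] [MeasurableSingletonClass A]
    [MeasurableSpace B] [MeasurableSingletonClass B]
    {G : Ω → A} {W : Ω → B} (hW : Measurable W) (h : IndepFun G W μ) (F : A → B → T) :
    entropy μ (fun ω => (F (G ω) (W ω), G ω))
      = entropy μ G + ∑ g, (μ (G ⁻¹' {g})).toReal * entropy μ (fun ω => F g (W ω)) := by
  unfold entropy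
  rw [Fintype.sum_prod_type_right, ← Finset.sum_add_distrib]
  refine Finset.sum_congr rfl fun g _ => ?_
  have hmeas (t : T) : MeasurableSet (F g ⁻¹' {t}) := (Set.toFinite _).measurableSet
  have hprod (t : T) : (μ ((fun ω => (F (G ω) (W ω), G ω)) ⁻¹' {(t, g)})).toReal
      = (μ (G ⁻¹' {g})).toReal * (μ ((fun ω => F g (W ω)) ⁻¹' {t})).toReal := by
    rw [← ENNReal.toReal_mul]
    have : (fun ω => (F (G ω) (W ω), G ω)) ⁻¹' {(t, g)} = G ⁻¹' {g} ∩ W ⁻¹' (F g ⁻¹' {t}) := by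
      ext ω
      simp only [Set.mem_preimage, Set.mem_singleton_iff, Prod.mk.injEq, Set.mem_inter_iff]
      constructor
      · rintro ⟨h₁, rfl⟩
        exact ⟨rfl, h₁⟩
      · rintro ⟨rfl, h₁⟩
        exact ⟨h₁, rfl⟩
    rw [this, h.measure_inter_preimage_eq_mul _ _ (measurableSet_singleton g) (hmeas t)]
    rfl
  simp_rw [hprod, Real.negMulLog_mul]
  rw [Finset.sum_add_distrib, ← Finset.sum_mul, ← Finset.mul_sum,
    sum_toReal_measure_preimage_singleton μ (X := fun ω => F g (W ω)) fun t => hW (hmeas t),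
    one_mul]

/-- If `G` is independent of `⟨X, Z⟩`, then `H(F(G, X) | ⟨Z, G⟩)` is the average over the values
`g` of `G` of `H(F(g, X) | Z)`. -/
theorem condEntropy_prodMk_of_indepFun {Ω : Type*} [MeasurableSpace Ω] (μ : Measure Ω)
    [IsProbabilityMeasure μ] {A B S T : Type*} [Fintype A] [Fintype B] [Fintype S] [Fintype T]
    [MeasurableSpace A] [MeasurableSingletonClass A]
    [MeasurableSpace B] [MeasurableSingletonClass B]
    [MeasurableSpace S] [MeasurableSingletonClass S]
    {G : Ω → A} {X : Ω → B} {Z : Ω → S} (hX : Measurable X) (hZ : Measurable Z)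
    (h : IndepFun G (fun ω => (X ω, Z ω)) μ) (F : A → B → T) :
    condEntropy μ (fun ω => F (G ω) (X ω)) (fun ω => (Z ω, G ω))
      = ∑ g, (μ (G ⁻¹' {g})).toReal * condEntropy μ (fun ω => F g (X ω)) Z := by
  have hassoc := entropy_comp_of_injective μ (fun ω => ((F (G ω) (X ω), Z ω), G ω))
    (Equiv.prodAssoc T S A).injective
  have hjoint := entropy_prodMk_of_indepFun μ (hX.prodMk hZ) h fun g w => (F g w.1, w.2)
  have hcond := entropy_prodMk_of_indepFun μ (hX.prodMk hZ) h fun _ w => w.2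
  simp only [Equiv.prodAssoc_apply] at hassoc hjoint hcond
  unfold condEntropy
  simp_rw [hassoc, hjoint, hcond, mul_sub, Finset.sum_sub_distrib]
  ring

/-- Conditional entropy is invariant under injective maps of the first variable. -/
theorem condEntropy_comp_of_injective {Ω : Type*} [MeasurableSpace Ω] (μ : Measure Ω)
    {S T U : Type*} [Fintype S] [Fintype T] [Fintype U] (X : Ω → S) (Z : Ω → U)
    {f : S → T} (hf : f.Injective) :
    condEntropy μ (fun ω => f (X ω)) Z = condEntropy μ X Z := by
  have := entropy_comp_of_injective μ (fun ω => (X ω, Z ω)) (hf.prodMap Function.injective_id)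
  simp only [Prod.map_apply, id_eq] at this
  rw [condEntropy, this, condEntropy]

/-- A constant has zero conditional entropy. -/
theorem condEntropy_const {Ω : Type*} [MeasurableSpace Ω] (μ : Measure Ω)
    {T U : Type*} [Fintype T] [Fintype U] (c : T) (Z : Ω → U) :
    condEntropy μ (fun _ => c) Z = 0 :=
  sub_eq_zero.mpr (entropy_comp_of_injective μ Z (Prod.mk_right_injective c))

/-- **Double masking identity.** If `G₁, G₂` are independent Bernoulli(`p`) random variables
and the pair `(G₁, G₂)` is independent of `⟨X, Z⟩`, then
`H(⟨G₁·X, G₂·X⟩ | ⟨Z, G₁, G₂⟩) = (1 − (1−p)²) · H(X | Z)`. -/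
theorem stmt_3 {Ω : Type*} [MeasurableSpace Ω] (μ : Measure Ω) [IsProbabilityMeasure μ]
    {S : Type*} [Fintype S] [MeasurableSpace S] [MeasurableSingletonClass S]
    (X : Ω → ZMod 2) (Z : Ω → S) (G₁ G₂ : Ω → Bool) (p : ℝ)
    (hX : Measurable X) (hZ : Measurable Z) (hG₁ : Measurable G₁) (hG₂ : Measurable G₂)
    (hp : p ∈ Set.Icc (0 : ℝ) 1)
    (hBer₁ : μ (G₁ ⁻¹' {true}) = ENNReal.ofReal p)
    (hBer₂ : μ (G₂ ⁻¹' {true}) = ENNReal.ofReal p)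
    (hG₁G₂ : IndepFun G₁ G₂ μ)
    (hindep : IndepFun (fun ω => (G₁ ω, G₂ ω)) (fun ω => (X ω, Z ω)) μ) :
    condEntropy μ (fun ω => (mask G₁ X ω, mask G₂ X ω)) (fun ω => (Z ω, G₁ ω, G₂ ω))
      = (1 - (1 - p) ^ 2) * condEntropy μ X Z := by
  have hF := condEntropy_prodMk_of_indepFun μ hX hZ hindep fun g x =>
    ((if g.1 then x else 0 : ZMod 2), (if g.2 then x else 0 : ZMod 2))
  have hsum := sum_toReal_measure_preimage_singleton μ
    (X := fun ω => (G₁ ω, G₂ ω)) fun g => (hG₁.prodMk hG₂) (measurableSet_singleton g)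
  have hfalse {G : Ω → Bool} (hG : Measurable G) (hBer : μ (G ⁻¹' {true}) = ENNReal.ofReal p) :
      (μ (G ⁻¹' {false})).toReal = 1 - p := by
    have := sum_toReal_measure_preimage_singleton μ fun b => hG (measurableSet_singleton b)
    rw [Fintype.sum_bool, hBer, ENNReal.toReal_ofReal hp.1] at this
    linarith
  have hff : (μ ((fun ω => (G₁ ω, G₂ ω)) ⁻¹' {(false, false)})).toReal = (1 - p) ^ 2 := by
    rw [← Set.singleton_prod_singleton, Set.mk_preimage_prod,
      hG₁G₂.measure_inter_preimage_eq_mul _ _ (measurableSet_singleton _)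
        (measurableSet_singleton _), ENNReal.toReal_mul, hfalse hG₁ hBer₁, hfalse hG₂ hBer₂, sq]
  have htt := condEntropy_comp_of_injective μ X Z (f := fun x => (x, x))
    fun _ _ h => congrArg Prod.fst h
  have htf := condEntropy_comp_of_injective μ X Z (Prod.mk_left_injective (0 : ZMod 2))
  have hft := condEntropy_comp_of_injective μ X Z (Prod.mk_right_injective (0 : ZMod 2))
  refine hF.trans ?_
  simp only [Fintype.sum_prod_type, Fintype.sum_bool, if_true, Bool.false_eq_true, if_false,
    htt, htf, hft, condEntropy_const, hff] at hsum ⊢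
  linear_combination condEntropy μ X Z * hsum
end

section
/- For every p ∈ [0,1], C_D(p) ⊆ C_I(p); for 0 ≤ p ≤ (3 − √5)/2 the two regions are equal, C_D(p) = C_I(p); and for (3 − √5)/2 < p < 1 the inclusion is strict, C_D(p) ⊊ C_I(p). -/
/-- The capacity region of the two-user binary fading interference channel with
Delayed-CSIT (Theorem 2 of the paper), with `q = 1 - p`. -/
def capacityD (p : ℝ) : Set (ℝ × ℝ) :=
  {R : ℝ × ℝ | 0 ≤ R.1 ∧ R.1 ≤ p ∧ 0 ≤ R.2 ∧ R.2 ≤ p ∧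
    R.1 + (1 + (1 - p)) * R.2 ≤ p * (1 + (1 - p)) ^ 2 ∧
    (1 + (1 - p)) * R.1 + R.2 ≤ p * (1 + (1 - p)) ^ 2}

/-- The capacity region with Instantaneous-CSIT (Theorem 1 of the paper). -/
def capacityI (p : ℝ) : Set (ℝ × ℝ) :=
  {R : ℝ × ℝ | 0 ≤ R.1 ∧ R.1 ≤ p ∧ 0 ≤ R.2 ∧ R.2 ≤ p ∧
    R.1 + R.2 ≤ 1 - (1 - p) ^ 2 + p * (1 - p)}

/-- The capacity region with No-CSIT. -/
def capacityNo (p : ℝ) : Set (ℝ × ℝ) :=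
  {R : ℝ × ℝ | 0 ≤ R.1 ∧ R.1 ≤ p ∧ 0 ≤ R.2 ∧ R.2 ≤ p ∧
    R.1 + R.2 ≤ 1 - (1 - p) ^ 2}

/-- The capacity region with Delayed-CSIT and output feedback (Theorem 3 of the paper). -/
def capacityDF (p : ℝ) : Set (ℝ × ℝ) :=
  {R : ℝ × ℝ | 0 ≤ R.1 ∧ 0 ≤ R.2 ∧
    R.1 + (1 + (1 - p)) * R.2 ≤ p * (1 + (1 - p)) ^ 2 ∧
    (1 + (1 - p)) * R.1 + R.2 ≤ p * (1 + (1 - p)) ^ 2}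

/-- The capacity region with Instantaneous-CSIT and output feedback (Theorem 4). -/
def capacityIF (p : ℝ) : Set (ℝ × ℝ) :=
  {R : ℝ × ℝ | 0 ≤ R.1 ∧ R.1 ≤ 1 - (1 - p) ^ 2 ∧ 0 ≤ R.2 ∧ R.2 ≤ 1 - (1 - p) ^ 2 ∧
    R.1 + R.2 ≤ 1 - (1 - p) ^ 2 + p * (1 - p)}

theorem capacityD_subset_capacityI {p : ℝ} (hp : p ∈ Set.Icc (0 : ℝ) 1) :
    capacityD p ⊆ capacityI p := by
  obtain ⟨hp0, hp1⟩ := hp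
  rintro ⟨x, y⟩ ⟨hx0, hx, hy0, hy, h₁, h₂⟩
  refine ⟨hx0, hx, hy0, hy, ?_⟩
  dsimp only at *
  have hpq : 0 ≤ p * (1 - p) := mul_nonneg hp0 (by linarith)
  have hsum : (x + y) * (3 - p) ≤ (1 - (1 - p) ^ 2 + p * (1 - p)) * (3 - p) := by
    linear_combination h₁ + h₂ + hpq
  exact le_of_mul_le_mul_right hsum (by linarith)

/-- When `q ^ 2 + q ≥ 1`, the weighted constraints of `capacityD p` hold on the whole box
`[0, p] × [0, p]`. -/
theorem capacityI_subset_capacityD {p : ℝ} (hp0 : 0 ≤ p) (hp1 : p ≤ 1)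
    (hq : 1 ≤ (1 - p) ^ 2 + (1 - p)) : capacityI p ⊆ capacityD p := by
  rintro ⟨x, y⟩ ⟨hx0, hx, hy0, hy, -⟩
  dsimp only at *
  have hcorner : 0 ≤ p * ((1 - p) ^ 2 + (1 - p) - 1) := mul_nonneg hp0 (by linarith)
  have hx' : 0 ≤ (1 + (1 - p)) * (p - x) := mul_nonneg (by linarith) (by linarith)
  have hy' : 0 ≤ (1 + (1 - p)) * (p - y) := mul_nonneg (by linarith) (by linarith)
  exact ⟨hx0, hx, hy0, hy, by dsimp only; linarith, by dsimp only; linarith⟩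

/-- When `q ^ 2 + q < 1`, the point `(p * min 1 (2 * q), p)` lies in `capacityI p` but not in
`capacityD p`. -/
theorem not_capacityI_subset_capacityD {p : ℝ} (hp0 : 0 < p) (hp1 : p < 1)
    (hq : (1 - p) ^ 2 + (1 - p) < 1) : ¬ capacityI p ⊆ capacityD p := by
  intro h
  have hmem : (p * min 1 (2 * (1 - p)), p) ∈ capacityI p := by
    have h₁ := mul_le_mul_of_nonneg_left (min_le_left 1 (2 * (1 - p))) hp0.le
    have h₂ := mul_le_mul_of_nonneg_left (min_le_right 1 (2 * (1 - p))) hp0.le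
    have h₀ : 0 ≤ min 1 (2 * (1 - p)) := le_min zero_le_one (by linarith)
    refine ⟨mul_nonneg hp0.le h₀, ?_, hp0.le, le_rfl, ?_⟩ <;> dsimp only <;> linarith
  obtain ⟨-, -, -, -, hle, -⟩ := h hmem
  have hgt : (1 - p) + (1 - p) ^ 2 < min 1 (2 * (1 - p)) :=
    lt_min (by linarith) (by nlinarith)
  have hpgt := mul_lt_mul_of_pos_left hgt hp0
  dsimp only at hle
  linarith

/-- `C_D(p) ⊆ C_I(p)` for all `p ∈ [0,1]`; the regions coincide for
`0 ≤ p ≤ (3 − √5)/2`; and the inclusion is strict for `(3 − √5)/2 < p < 1`. -/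
theorem stmt_9 :
    (∀ p : ℝ, p ∈ Set.Icc (0 : ℝ) 1 → capacityD p ⊆ capacityI p) ∧
    (∀ p : ℝ, 0 ≤ p → p ≤ (3 - Real.sqrt 5) / 2 → capacityD p = capacityI p) ∧
    (∀ p : ℝ, (3 - Real.sqrt 5) / 2 < p → p < 1 → capacityD p ⊂ capacityI p) := by
  have h5 : Real.sqrt 5 ^ 2 = 5 := Real.sq_sqrt (by norm_num)
  have h5_lower : 2 < Real.sqrt 5 := Real.lt_sqrt_of_sq_lt (by norm_num)
  have h5_upper : Real.sqrt 5 < 3 := (Real.sqrt_lt' (by norm_num)).2 (by norm_num)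
  refine ⟨fun p hp => capacityD_subset_capacityI hp, fun p hp0 hp => ?_, fun p hp hp1 => ?_⟩
  · have hp1 : p ≤ 1 := by linarith
    exact (capacityD_subset_capacityI ⟨hp0, hp1⟩).antisymm
      (capacityI_subset_capacityD hp0 hp1 (by nlinarith))
  · have hp0 : 0 < p := by linarith
    exact ⟨capacityD_subset_capacityI ⟨hp0.le, hp1.le⟩,
      not_capacityI_subset_capacityD hp0 hp1 (by nlinarith)⟩
end

section
/- (Sum-rate capacity with Delayed-CSIT.) For every p ∈ [0,1], the maximum of R₁ + R₂ over (R₁,R₂) ∈ C_D(p) exists and equals min(2p, 2p·(1+q)²/(2+q)); in particular it equals 2p when 0 ≤ p ≤ (3 − √5)/2 and equals 2p·(1+q)²/(2+q) when (3 − √5)/2 ≤ p ≤ 1. -/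
/-- The maximum is attained on the diagonal: the last two constraints sum to
`(3 - p) * (R.1 + R.2) ≤ 2 * p * (2 - p) ^ 2`. -/
theorem isGreatest_sum_capacityD {p : ℝ} (hp : p ∈ Set.Icc (0 : ℝ) 1) :
    IsGreatest ((fun R : ℝ × ℝ => R.1 + R.2) '' capacityD p)
      (min (2 * p) (2 * p * (1 + (1 - p)) ^ 2 / (2 + (1 - p)))) := by
  obtain ⟨hp0, hp1⟩ := hp
  have hpos : 0 < 2 + (1 - p) := by linarith
  constructor
  · set m := min (2 * p) (2 * p * (1 + (1 - p)) ^ 2 / (2 + (1 - p)))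
    have hm0 : 0 ≤ m := le_min (by positivity) (by positivity)
    have hm1 : m ≤ 2 * p := min_le_left _ _
    have hm2 : m * (2 + (1 - p)) ≤ 2 * p * (1 + (1 - p)) ^ 2 :=
      (le_div_iff₀ hpos).mp (min_le_right _ _)
    refine ⟨(m / 2, m / 2), ⟨?_, ?_, ?_, ?_, ?_, ?_⟩, add_halves m⟩ <;> dsimp only <;> linarith
  · rintro _ ⟨R, ⟨-, h1, -, h2, h3, h4⟩, rfl⟩
    refine le_min (by dsimp only; linarith) ((le_div_iff₀ hpos).mpr ?_)
    dsimp only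
    linarith

/-- The difference of the two bounds on the sum rate changes sign at the smaller root of
`p ^ 2 - 3 * p + 1`. -/
theorem sum_bound_sub_eq {p : ℝ} (hp : p ≤ 1) :
    2 * p * (1 + (1 - p)) ^ 2 / (2 + (1 - p)) - 2 * p =
      2 * p * ((3 + Real.sqrt 5) / 2 - p) / (2 + (1 - p)) * ((3 - Real.sqrt 5) / 2 - p) := by
  have hpos : 2 + (1 - p) ≠ 0 := by linarith
  have h5 : Real.sqrt 5 ^ 2 = 5 := Real.sq_sqrt (by norm_num)
  field_simp
  linear_combination p * h5

/-- **Sum-rate capacity with Delayed-CSIT.** For `p ∈ [0,1]` and `q = 1 − p`, the maximum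
of `R₁ + R₂` over `C_D(p)` exists and equals `min (2p) (2p(1+q)²/(2+q))`; in particular it
equals `2p` for `0 ≤ p ≤ (3 − √5)/2` and `2p(1+q)²/(2+q)` for `(3 − √5)/2 ≤ p ≤ 1`. -/
theorem stmt_12 (p : ℝ) (hp : p ∈ Set.Icc (0 : ℝ) 1) :
    IsGreatest ((fun R : ℝ × ℝ => R.1 + R.2) '' capacityD p)
      (min (2 * p) (2 * p * (1 + (1 - p)) ^ 2 / (2 + (1 - p)))) ∧
    (p ≤ (3 - Real.sqrt 5) / 2 →
      IsGreatest ((fun R : ℝ × ℝ => R.1 + R.2) '' capacityD p) (2 * p)) ∧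
    ((3 - Real.sqrt 5) / 2 ≤ p →
      IsGreatest ((fun R : ℝ × ℝ => R.1 + R.2) '' capacityD p)
        (2 * p * (1 + (1 - p)) ^ 2 / (2 + (1 - p)))) := by
  have hmax := isGreatest_sum_capacityD hp
  have hsub := sum_bound_sub_eq hp.2
  have hcoef : 0 ≤ 2 * p * ((3 + Real.sqrt 5) / 2 - p) / (2 + (1 - p)) := by
    obtain ⟨hp0, hp1⟩ := hp
    have h5 := Real.sqrt_nonneg 5
    exact div_nonneg (mul_nonneg (by linarith) (by linarith)) (by linarith)
  refine ⟨hmax, fun h => ?_, fun h => ?_⟩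
  · have := mul_nonneg hcoef (sub_nonneg.mpr h)
    rwa [min_eq_left (by linarith)] at hmax
  · have := mul_nonpos_of_nonneg_of_nonpos hcoef (sub_nonpos.mpr h)
    rwa [min_eq_right (by linarith)] at hmax
end

section
/- (Sum-rate capacity with Delayed-CSIT and output feedback, and the feedback sum-rate gain.) For every p ∈ [0,1], the maximum of R₁ + R₂ over (R₁,R₂) ∈ C_DF(p) exists and equals 2p·(1+q)²/(2+q). Moreover, this value strictly exceeds the maximum of R₁ + R₂ over C_D(p) if and only if 0 < p < (3 − √5)/2. -/
/-- The sum of the two weighted constraints bounds the sum-rate. -/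
lemma add_le_of_weighted_le {a c x y : ℝ} (ha : 0 < 1 + a)
    (h₁ : x + a * y ≤ c) (h₂ : a * x + y ≤ c) : x + y ≤ 2 * c / (1 + a) := by
  rw [le_div_iff₀ ha]
  linarith

/-- The symmetric corner point saturates a weighted constraint. -/
lemma add_mul_div_one_add {a c : ℝ} (ha : 0 < 1 + a) :
    c / (1 + a) + a * (c / (1 + a)) = c := by
  field_simp

lemma mk_mem_capacityDF {p : ℝ} (hp : p ∈ Set.Icc (0 : ℝ) 1) :
    (p * (1 + (1 - p)) ^ 2 / (1 + (1 + (1 - p))), p * (1 + (1 - p)) ^ 2 / (1 + (1 + (1 - p)))) ∈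
      capacityDF p := by
  obtain ⟨h0, h1⟩ := hp
  have ha : 0 < 1 + (1 + (1 - p)) := by linarith
  have hr : 0 ≤ p * (1 + (1 - p)) ^ 2 / (1 + (1 + (1 - p))) := by positivity
  have hs := add_mul_div_one_add (c := p * (1 + (1 - p)) ^ 2) ha
  exact ⟨hr, hr, hs.le, by rw [add_comm]; exact hs.le⟩

lemma lt_three_sub_sqrt_five_div_two_iff {p : ℝ} (hp : p ≤ 1) :
    p < (3 - Real.sqrt 5) / 2 ↔ 1 + (1 + (1 - p)) < (1 + (1 - p)) ^ 2 := by
  have h : p < (3 - Real.sqrt 5) / 2 ↔ Real.sqrt 5 < 3 - 2 * p := by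
    constructor <;> intro h <;> linarith
  rw [h, Real.sqrt_lt' (by linarith)]
  constructor <;> intro h <;> nlinarith


/-- **Sum-rate capacity with Delayed-CSIT and output feedback, and the feedback sum-rate
gain.** For `p ∈ [0,1]` and `q = 1 − p`, the maximum of `R₁ + R₂` over `C_DF(p)` exists and
equals `2p(1+q)²/(2+q)`; moreover this value strictly exceeds the maximum of `R₁ + R₂` over
`C_D(p)` if and only if `0 < p < (3 − √5)/2`. -/
theorem stmt_13 (p : ℝ) (hp : p ∈ Set.Icc (0 : ℝ) 1) :
    IsGreatest ((fun R : ℝ × ℝ => R.1 + R.2) '' capacityDF p)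
      (2 * p * (1 + (1 - p)) ^ 2 / (2 + (1 - p))) ∧
    (∀ v : ℝ, IsGreatest ((fun R : ℝ × ℝ => R.1 + R.2) '' capacityD p) v →
      (v < 2 * p * (1 + (1 - p)) ^ 2 / (2 + (1 - p)) ↔
        0 < p ∧ p < (3 - Real.sqrt 5) / 2)) := by
  obtain ⟨h0, h1⟩ := id hp
  have ha : 0 < 1 + (1 + (1 - p)) := by linarith
  have hmem := mk_mem_capacityDF hp
  have hden : 2 + (1 - p) = 1 + (1 + (1 - p)) := by ring
  rw [hden, lt_three_sub_sqrt_five_div_two_iff h1, mul_assoc]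
  have hsum : 2 * (p * (1 + (1 - p)) ^ 2) / (1 + (1 + (1 - p))) =
      p * (1 + (1 - p)) ^ 2 / (1 + (1 + (1 - p))) +
        p * (1 + (1 - p)) ^ 2 / (1 + (1 + (1 - p))) := by ring
  refine ⟨⟨⟨_, hmem, hsum.symm⟩, ?_⟩, fun v hv => ⟨fun hlt => ?_, ?_⟩⟩
  · rintro _ ⟨R, ⟨-, -, hR₁, hR₂⟩, rfl⟩
    exact add_le_of_weighted_le ha hR₁ hR₂
  · by_contra hneg
    have hle : p * (1 + (1 - p)) ^ 2 / (1 + (1 + (1 - p))) ≤ p := by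
      rw [div_le_iff₀ ha]
      rcases h0.eq_or_lt with rfl | hpos
      · simp
      · exact mul_le_mul_of_nonneg_left (not_lt.mp fun h => hneg ⟨hpos, h⟩) h0
    obtain ⟨hr, -, hs₁, hs₂⟩ := hmem
    have hge := hv.2 ⟨_, ⟨hr, hle, hr, hle, hs₁, hs₂⟩, rfl⟩
    exact absurd (hlt.trans_eq hsum) (not_lt.mpr hge)
  · rintro ⟨hpos, hsq⟩
    obtain ⟨⟨R, ⟨-, hR₁, -, hR₂, -, -⟩, rfl⟩, -⟩ := hv
    have hlt : p < p * (1 + (1 - p)) ^ 2 / (1 + (1 + (1 - p))) := by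
      rw [lt_div_iff₀ ha]
      exact mul_lt_mul_of_pos_left hsq hpos
    rw [hsum]
    exact add_lt_add (hR₁.trans_lt hlt) (hR₂.trans_lt hlt)
end
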